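/- arXiv:math/0108042 — 2 statements merged into one kernel-verified Lean document; each statement's English description precedes it below -/
import Mathlib

section
/- For all g, h ∈ SU(3): Φ(g)∘Φ(h) = ∫_{U(2)} χ(A⁻¹)·Φ(g·k(A)·h) dA, where the integral of a continuous End(V_ℓ)-valued function over U(2) is taken with respect to the normalized Haar (probability) measure on U(2). (This says Φ = Φ_{n,ℓ} satisfies the defining integral equation of a spherical function of type (n,ℓ) for the pair (SU(3), S(U(2)×U(1))).) -/
open MeasureTheory MvPolynomial Matrix

/-- The ℓ-th symmetric power action of a 2×2 matrix on polynomials in two variables,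
induced by the substitution `X ↦ a₁₁X + a₂₁Y`, `Y ↦ a₁₂X + a₂₂Y`. -/
noncomputable def symPowAct (A : Matrix (Fin 2) (Fin 2) ℂ) :
    MvPolynomial (Fin 2) ℂ →ₐ[ℂ] MvPolynomial (Fin 2) ℂ :=
  aeval fun j => A 0 j • X 0 + A 1 j • X 1

/-- The representation `π_{n,ℓ}(A) = (det A)^n · Sym^ℓ(A)` acting on polynomials. -/
noncomputable def piAct (n : ℕ) (A : Matrix (Fin 2) (Fin 2) ℂ)
    (P : MvPolynomial (Fin 2) ℂ) : MvPolynomial (Fin 2) ℂ :=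
  A.det ^ n • symPowAct A P

/-- Exponent of the monomial `X^k Y^(ℓ-k)`. -/
noncomputable def monExp (ℓ k : ℕ) : Fin 2 →₀ ℕ :=
  Finsupp.single 0 k + Finsupp.single 1 (ℓ - k)

/-- `χ(A) = (ℓ+1) · trace(π_{n,ℓ}(A))`, the trace being computed in the monomial basis
`X^k Y^(ℓ-k)`, `k = 0, …, ℓ`, of the space `V_ℓ` of homogeneous polynomials of degree ℓ. -/
noncomputable def chiFn (n ℓ : ℕ) (A : Matrix (Fin 2) (Fin 2) ℂ) : ℂ :=
  (ℓ + 1) * ∑ k ∈ Finset.range (ℓ + 1),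
    coeff (monExp ℓ k) (piAct n A (monomial (monExp ℓ k) 1))

/-- The upper-left 2×2 block of a 3×3 matrix. -/
def blockA (g : Matrix (Fin 3) (Fin 3) ℂ) : Matrix (Fin 2) (Fin 2) ℂ :=
  g.submatrix Fin.castSucc Fin.castSucc

/-- The embedding `U(2) → SU(3)`, `A ↦ diag(A, (det A)⁻¹)`, with image
`K = S(U(2)×U(1))`. -/
noncomputable def embedK (A : Matrix (Fin 2) (Fin 2) ℂ) : Matrix (Fin 3) (Fin 3) ℂ :=
  Matrix.of fun i j =>
    if hi : (i : ℕ) < 2 then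
      if hj : (j : ℕ) < 2 then A ⟨i, hi⟩ ⟨j, hj⟩ else 0
    else if (j : ℕ) < 2 then 0 else A.det⁻¹

theorem symPowAct_X (A : Matrix (Fin 2) (Fin 2) ℂ) (j : Fin 2) :
    symPowAct A (X j) = A 0 j • X 0 + A 1 j • X 1 := by
  simp [symPowAct]

theorem symPowAct_mul (A B : Matrix (Fin 2) (Fin 2) ℂ) (P : MvPolynomial (Fin 2) ℂ) :
    symPowAct (A * B) P = symPowAct A (symPowAct B P) := by
  have : symPowAct (A * B) = (symPowAct A).comp (symPowAct B) := by
    apply MvPolynomial.algHom_ext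
    intro j
    simp only [AlgHom.comp_apply, symPowAct_X, map_add, map_smul, Matrix.mul_apply,
      Fin.sum_univ_two]
    module
  rw [this]; rfl

theorem symPowAct_one (P : MvPolynomial (Fin 2) ℂ) : symPowAct 1 P = P := by
  have : symPowAct 1 = AlgHom.id ℂ _ := by
    apply MvPolynomial.algHom_ext
    intro j
    fin_cases j <;> simp [symPowAct_X]
  rw [this]; rfl

theorem symPowAct_homog (A : Matrix (Fin 2) (Fin 2) ℂ) (P : MvPolynomial (Fin 2) ℂ) (ℓ : ℕ)
    (hP : P.IsHomogeneous ℓ) : (symPowAct A P).IsHomogeneous ℓ := by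
  have := hP.aeval (fun j => A 0 j • X 0 + A 1 j • (X 1 : MvPolynomial (Fin 2) ℂ)) (n := 1) (fun j => by
    apply IsHomogeneous.add
    · rw [smul_eq_C_mul]; simpa using (isHomogeneous_C _ _).mul (isHomogeneous_X ℂ (0 : Fin 2))
    · rw [smul_eq_C_mul]; simpa using (isHomogeneous_C _ _).mul (isHomogeneous_X ℂ (1 : Fin 2)))
  simpa [symPowAct] using this

theorem degree_monExp (ℓ k : ℕ) (hk : k ≤ ℓ) : (monExp ℓ k).degree = ℓ := by
  rw [monExp, map_add, Finsupp.degree_single, Finsupp.degree_single]; omega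

theorem monExp_inj (ℓ i k : ℕ) : monExp ℓ i = monExp ℓ k ↔ i = k := by
  constructor
  · intro h
    have := DFunLike.congr_fun h 0
    simpa [monExp] using this
  · rintro rfl; rfl

theorem homog_expand (P : MvPolynomial (Fin 2) ℂ) (ℓ : ℕ) (hP : P.IsHomogeneous ℓ) :
    P = ∑ k ∈ Finset.range (ℓ + 1), coeff (monExp ℓ k) P • monomial (monExp ℓ k) 1 := by
  ext d
  simp only [coeff_sum, coeff_smul, coeff_monomial, smul_eq_mul, mul_ite, mul_one, mul_zero]
  by_cases hd : d.degree = ℓ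
  · have hd2 : d 0 + d 1 = ℓ := by
      rw [← hd, Finsupp.degree_eq_sum]; simp
    have : d = monExp ℓ (d 0) := by
      ext i; fin_cases i
      · simp [monExp]
      · simp [monExp]; omega
    rw [this]
    simp only [monExp_inj]
    rw [Finset.sum_ite_eq']
    simp [show d 0 < ℓ + 1 by omega]
  · have h1 : coeff d P = 0 := hP.coeff_eq_zero hd
    rw [h1, Finset.sum_eq_zero]
    intro k hk
    rw [if_neg]
    rintro rfl
    exact hd (degree_monExp ℓ k (by simpa [Nat.lt_succ_iff] using hk))

theorem symPowAct_smul (c : ℂ) (A : Matrix (Fin 2) (Fin 2) ℂ) (P : MvPolynomial (Fin 2) ℂ) (ℓ : ℕ)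
    (hP : P.IsHomogeneous ℓ) : symPowAct (c • A) P = c ^ ℓ • symPowAct A P := by
  rw [homog_expand P ℓ hP]
  simp only [map_sum, map_smul, Finset.smul_sum]
  apply Finset.sum_congr rfl
  intro k hk
  rw [smul_comm]
  congr 1
  have hX : ∀ j, symPowAct (c • A) (X j) = c • symPowAct A (X j) := by
    intro j; simp only [symPowAct_X, Matrix.smul_apply, smul_eq_mul]; module
  have : (monomial (monExp ℓ k) 1 : MvPolynomial (Fin 2) ℂ) = X 0 ^ k * X 1 ^ (ℓ - k) := by
    rw [monExp, X_pow_eq_monomial, X_pow_eq_monomial, monomial_mul, one_mul]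
  rw [this]
  simp only [map_mul, map_pow, hX, smul_pow, smul_mul_smul_comm]
  rw [← pow_add]
  congr 2
  have := Finset.mem_range.1 hk
  omega

theorem piAct_smul (n : ℕ) (c : ℂ) (A : Matrix (Fin 2) (Fin 2) ℂ) (P : MvPolynomial (Fin 2) ℂ) (ℓ : ℕ)
    (hP : P.IsHomogeneous ℓ) : piAct n (c • A) P = c ^ (2 * n + ℓ) • piAct n A P := by
  rw [piAct, piAct, symPowAct_smul c A P ℓ hP, Matrix.det_smul, smul_smul, smul_smul]
  congr 1
  simp; ring

theorem monomial_homog (ℓ k : ℕ) (hk : k ≤ ℓ) :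
    (monomial (monExp ℓ k) (1 : ℂ)).IsHomogeneous ℓ :=
  isHomogeneous_monomial _ (degree_monExp ℓ k hk)

theorem chiFn_smul (n ℓ : ℕ) (c : ℂ) (A : Matrix (Fin 2) (Fin 2) ℂ) :
    chiFn n ℓ (c • A) = c ^ (2 * n + ℓ) * chiFn n ℓ A := by
  rw [chiFn, chiFn, mul_left_comm, Finset.mul_sum _ _ (c ^ _)]
  congr 1
  apply Finset.sum_congr rfl
  intro k hk
  rw [piAct_smul n c A _ ℓ (monomial_homog ℓ k (by simpa [Nat.lt_succ_iff] using hk)), coeff_smul, smul_eq_mul]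

/-- matrix coefficients -/
noncomputable def symMat (ℓ : ℕ) (A : Matrix (Fin 2) (Fin 2) ℂ) (k i : ℕ) : ℂ :=
  coeff (monExp ℓ k) (symPowAct A (monomial (monExp ℓ i) 1))

theorem symMat_mul (ℓ : ℕ) (A B : Matrix (Fin 2) (Fin 2) ℂ) (k i : ℕ) (hi : i ≤ ℓ) :
    symMat ℓ (A * B) k i = ∑ p ∈ Finset.range (ℓ + 1), symMat ℓ A k p * symMat ℓ B p i := by
  rw [symMat, symPowAct_mul,
    homog_expand _ ℓ (symPowAct_homog B _ ℓ (monomial_homog ℓ i hi))]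
  simp only [map_sum, map_smul, coeff_sum, coeff_smul, smul_eq_mul]
  apply Finset.sum_congr rfl
  intro p _
  rw [mul_comm]; rfl

theorem symMat_one (ℓ k i : ℕ) : symMat ℓ 1 k i = if i = k then 1 else 0 := by
  rw [symMat, symPowAct_one, coeff_monomial]
  simp [monExp_inj]

theorem continuous_coeff_symPowAct (P : MvPolynomial (Fin 2) ℂ) : ∀ d : Fin 2 →₀ ℕ,
    Continuous fun A : Matrix (Fin 2) (Fin 2) ℂ => coeff d (symPowAct A P) := by
  induction P using MvPolynomial.induction_on with
  | C a => intro d; simp [symPowAct]; fun_prop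
  | add p q hp hq => intro d; simp only [map_add, coeff_add]; exact (hp d).add (hq d)
  | mul_X p j hp =>
    intro d
    simp only [map_mul, symPowAct_X, mul_add, mul_smul_comm, coeff_add, coeff_smul, smul_eq_mul,
      coeff_mul_X']
    have h0 : ∀ i j, Continuous fun A : Matrix (Fin 2) (Fin 2) ℂ => A i j := by
      intro i j; fun_prop
    split_ifs <;> have := hp <;> fun_prop

theorem continuous_coeff_piAct (n : ℕ) (P : MvPolynomial (Fin 2) ℂ) (d : Fin 2 →₀ ℕ) :
    Continuous fun A : Matrix (Fin 2) (Fin 2) ℂ => coeff d (piAct n A P) := by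
  simp only [piAct, coeff_smul, smul_eq_mul]
  have := continuous_coeff_symPowAct P d
  fun_prop

theorem continuous_chiFn (n ℓ : ℕ) : Continuous (chiFn n ℓ) := by
  unfold chiFn
  have := continuous_coeff_piAct n
  fun_prop

theorem poly_symPowAct (P : MvPolynomial (Fin 2) ℂ) : ∃ D : ℕ, ∀ (d : Fin 2 →₀ ℕ)
    (M N : Matrix (Fin 2) (Fin 2) ℂ), ∃ p : Polynomial ℂ, p.natDegree ≤ D ∧
      ∀ x : ℂ, coeff d (symPowAct (M + x • N) P) = p.eval x := by
  induction P using MvPolynomial.induction_on with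
  | C a =>
    refine ⟨0, fun d M N => ⟨Polynomial.C (coeff d (C a)), by simp, fun x => ?_⟩⟩
    simp [symPowAct]
  | add p q hp hq =>
    obtain ⟨D1, h1⟩ := hp
    obtain ⟨D2, h2⟩ := hq
    refine ⟨max D1 D2, fun d M N => ?_⟩
    obtain ⟨r1, hr1, e1⟩ := h1 d M N
    obtain ⟨r2, hr2, e2⟩ := h2 d M N
    refine ⟨r1 + r2, (Polynomial.natDegree_add_le _ _).trans (max_le_max hr1 hr2), fun x => ?_⟩
    simp [e1, e2]
  | mul_X p j hp =>
    obtain ⟨D, hD⟩ := hp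
    have key : ∀ (d : Fin 2 →₀ ℕ) (M N : Matrix (Fin 2) (Fin 2) ℂ) (i : Fin 2), 
        ∃ p' : Polynomial ℂ, p'.natDegree ≤ 1 + D ∧
        ∀ x : ℂ, (M + x • N) i j * coeff d (symPowAct (M + x • N) p * X i) = p'.eval x := by
      intro d M N i
      simp only [coeff_mul_X']
      split_ifs
      · obtain ⟨r, hr, e⟩ := hD (d - Finsupp.single i 1) M N
        refine ⟨(Polynomial.C (N i j) * Polynomial.X + Polynomial.C (M i j)) * r, ?_, fun x => ?_⟩
        · exact Polynomial.natDegree_mul_le.trans (add_le_add Polynomial.natDegree_linear_le hr)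
        · simp [e]; left; ring
      · exact ⟨0, by simp, by simp⟩
    refine ⟨1 + D, fun d M N => ?_⟩
    obtain ⟨r1, hr1, e1⟩ := key d M N 0
    obtain ⟨r2, hr2, e2⟩ := key d M N 1
    refine ⟨r1 + r2, (Polynomial.natDegree_add_le _ _).trans (max_le hr1 hr2), fun x => ?_⟩
    rw [Polynomial.eval_add, ← e1, ← e2]
    simp only [map_mul, symPowAct_X, mul_add, mul_smul_comm, coeff_add, coeff_smul, smul_eq_mul]

theorem poly_piAct (n : ℕ) (P : MvPolynomial (Fin 2) ℂ) : ∃ D : ℕ, ∀ (d : Fin 2 →₀ ℕ)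
    (M N : Matrix (Fin 2) (Fin 2) ℂ), ∃ p : Polynomial ℂ, p.natDegree ≤ D ∧
      ∀ x : ℂ, coeff d (piAct n (M + x • N) P) = p.eval x := by
  obtain ⟨D, hD⟩ := poly_symPowAct P
  refine ⟨n * 2 + D, fun d M N => ?_⟩
  obtain ⟨r, hr, e⟩ := hD d M N
  let L : Fin 2 → Fin 2 → Polynomial ℂ := fun i j =>
    Polynomial.C (N i j) * Polynomial.X + Polynomial.C (M i j)
  have hL : ∀ i j, (L i j).natDegree ≤ 1 := fun i j => Polynomial.natDegree_linear_le
  refine ⟨(L 0 0 * L 1 1 - L 0 1 * L 1 0) ^ n * r, ?_, fun x => ?_⟩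
  · refine Polynomial.natDegree_mul_le.trans (add_le_add ?_ hr)
    refine Polynomial.natDegree_pow_le.trans (Nat.mul_le_mul_left _ ?_)
    refine (Polynomial.natDegree_sub_le _ _).trans (max_le ?_ ?_) <;>
    exact Polynomial.natDegree_mul_le.trans (add_le_add (hL _ _) (hL _ _))
  · simp [piAct, e, Matrix.det_fin_two, L]; left; ring

theorem root_average (D : ℕ) (p : Polynomial ℂ) (hp : p.natDegree ≤ D) (ζ : ℂ)
    (hζ : IsPrimitiveRoot ζ (D + 1)) (x : ℂ) :
    ∑ k ∈ Finset.range (D + 1), p.eval (ζ ^ k * x) = (D + 1) * p.eval 0 := by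
  simp only [Polynomial.eval_eq_sum_range' (Nat.lt_succ_of_le hp)]
  rw [Finset.sum_comm, Finset.sum_eq_single 0]
  · simp [Finset.sum_range_succ']
  · intro j hj hj0
    have hj' := Finset.mem_range.1 hj
    have hne : ζ ^ j ≠ 1 := hζ.pow_ne_one_of_pos_of_lt hj0 hj'
    have hg : ∑ k ∈ Finset.range (D + 1), (ζ ^ j) ^ k = 0 := by
      rw [geom_sum_eq hne, ← pow_mul, mul_comm, pow_mul, hζ.pow_eq_one]; simp
    calc _ = p.coeff j * x ^ j * ∑ k ∈ Finset.range (D + 1), (ζ ^ j) ^ k := by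
          rw [Finset.mul_sum]
          apply Finset.sum_congr rfl
          intro k _
          rw [mul_pow, ← pow_mul, ← pow_mul, mul_comm k j]; ring
      _ = 0 := by rw [hg, mul_zero]
  · simp

theorem compactSpace_U2 : CompactSpace (Matrix.unitaryGroup (Fin 2) ℂ) := by
  apply isCompact_iff_compactSpace.1
  have hc : IsCompact (Set.univ.pi fun _ : Fin 2 => Set.univ.pi fun _ : Fin 2 =>
      Metric.closedBall (0 : ℂ) 1) :=
    isCompact_univ_pi fun _ => isCompact_univ_pi fun _ => isCompact_closedBall _ _
  refine IsCompact.of_isClosed_subset (t := (Matrix.unitaryGroup (Fin 2) ℂ : Set (Matrix (Fin 2) (Fin 2) ℂ))) hc ?_ ?_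
  · have : ((Matrix.unitaryGroup (Fin 2) ℂ : Set (Matrix (Fin 2) (Fin 2) ℂ))) =
      {A : Matrix (Fin 2) (Fin 2) ℂ | A * star A = 1} := by
      ext A; simp [Matrix.mem_unitaryGroup_iff]
    rw [this]
    exact isClosed_eq (by fun_prop) (by fun_prop)
  · intro A hA
    refine Set.mem_univ_pi.2 fun i => Set.mem_univ_pi.2 fun j => ?_
    simpa using entry_norm_bound_of_unitary hA i j

theorem integrable_U2 [MeasurableSpace (Matrix.unitaryGroup (Fin 2) ℂ)]
    [BorelSpace (Matrix.unitaryGroup (Fin 2) ℂ)]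
    (μ : Measure (Matrix.unitaryGroup (Fin 2) ℂ)) [IsProbabilityMeasure μ]
    (f : Matrix.unitaryGroup (Fin 2) ℂ → ℂ) (hf : Continuous f) : Integrable f μ := by
  have := compactSpace_U2
  exact hf.integrable_of_hasCompactSupport (HasCompactSupport.of_compactSpace f)

theorem diag_mem (z : ℂ) (hz : ‖z‖ = 1) :
    Matrix.diagonal ![1, z] ∈ Matrix.unitaryGroup (Fin 2) ℂ := by
  rw [Matrix.mem_unitaryGroup_iff]
  have : z * star z = 1 := by
    have := Complex.mul_conj' z
    simpa [hz] using this
  ext i j; fin_cases i <;> fin_cases j <;> simp [Matrix.mul_apply, Matrix.diagonal]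
  simpa using this

theorem scalar_mem (z : ℂ) (hz : ‖z‖ = 1) :
    z • (1 : Matrix (Fin 2) (Fin 2) ℂ) ∈ Matrix.unitaryGroup (Fin 2) ℂ := by
  rw [Matrix.mem_unitaryGroup_iff]
  have : z * star z = 1 := by
    have := Complex.mul_conj' z
    simpa [hz] using this
  rw [star_smul, smul_mul_smul_comm, this]; simp

theorem rot_mem : !![(3/5 : ℂ), 4/5; -4/5, 3/5] ∈ Matrix.unitaryGroup (Fin 2) ℂ := by
  rw [Matrix.mem_unitaryGroup_iff]
  ext i j; fin_cases i <;> fin_cases j <;> simp [Matrix.mul_apply, Fin.sum_univ_two, Complex.conj_ofNat] <;> norm_num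

theorem symMat_diag (ℓ k i : ℕ) (z : ℂ) :
    symMat ℓ (Matrix.diagonal ![1, z]) k i = if i = k then z ^ (ℓ - k) else 0 := by
  have : (monomial (monExp ℓ i) 1 : MvPolynomial (Fin 2) ℂ) = X 0 ^ i * X 1 ^ (ℓ - i) := by
    rw [monExp, X_pow_eq_monomial, X_pow_eq_monomial, monomial_mul, one_mul]
  have h2 : symPowAct (Matrix.diagonal ![1, z]) (monomial (monExp ℓ i) 1) =
      z ^ (ℓ - i) • monomial (monExp ℓ i) 1 := by
    rw [this]
    simp [symPowAct_X, Matrix.diagonal, smul_pow]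
  rw [symMat, h2, coeff_smul, coeff_monomial]
  simp only [monExp_inj]
  split_ifs with h
  · simp [h]
  · simp

theorem symMat_rot_ne (ℓ k : ℕ) (hk : k ≤ ℓ) (A : Matrix (Fin 2) (Fin 2) ℂ) (h0 : A 0 0 ≠ 0)
    (h1 : A 1 0 ≠ 0) : symMat ℓ A k ℓ ≠ 0 := by
  have : (monomial (monExp ℓ ℓ) 1 : MvPolynomial (Fin 2) ℂ) = X 0 ^ ℓ := by
    simp [monExp, X_pow_eq_monomial]
  have h2 : symPowAct A (monomial (monExp ℓ ℓ) 1) =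
      ∑ m ∈ Finset.range (ℓ + 1),
        (A 0 0 ^ m * A 1 0 ^ (ℓ - m) * (ℓ.choose m : ℂ)) • monomial (monExp ℓ m) 1 := by
    rw [this, map_pow, symPowAct_X, add_pow]
    apply Finset.sum_congr rfl
    intro m _
    rw [monExp, smul_pow, smul_pow, smul_mul_smul_comm, X_pow_eq_monomial, X_pow_eq_monomial, monomial_mul, one_mul,
      mul_comm _ (ℓ.choose m : MvPolynomial (Fin 2) ℂ), ← C_eq_coe_nat, ← smul_eq_C_mul, smul_smul]
    congr 1; ring
  rw [symMat, h2]
  simp only [coeff_sum, coeff_smul, coeff_monomial, monExp_inj, smul_eq_mul, mul_ite, mul_one, mul_zero]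
  rw [Finset.sum_ite_eq', if_pos (by simp; omega)]
  have : ((ℓ.choose k : ℕ) : ℂ) ≠ 0 := by
    exact_mod_cast (Nat.choose_pos hk).ne'
  positivity

theorem continuous_symMat (ℓ k i : ℕ) : Continuous fun A : Matrix (Fin 2) (Fin 2) ℂ =>
    symMat ℓ A k i := continuous_coeff_symPowAct _ _

theorem schur_orth (ℓ : ℕ) [MeasurableSpace (Matrix.unitaryGroup (Fin 2) ℂ)]
    [BorelSpace (Matrix.unitaryGroup (Fin 2) ℂ)]
    (μ : Measure (Matrix.unitaryGroup (Fin 2) ℂ))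
    [μ.IsHaarMeasure] [IsProbabilityMeasure μ] (i j k l : ℕ) (hi : i ≤ ℓ) (hk : k ≤ ℓ)
    (hl : l ≤ ℓ) :
    ∫ A : Matrix.unitaryGroup (Fin 2) ℂ, symMat ℓ (A : Matrix (Fin 2) (Fin 2) ℂ) k i *
      symMat ℓ ((A⁻¹ : Matrix.unitaryGroup (Fin 2) ℂ) : Matrix (Fin 2) (Fin 2) ℂ) j l ∂μ =
      if k = l ∧ i = j then ((ℓ : ℂ) + 1)⁻¹ else 0 := by
  let E : ℕ → ℕ → ℂ := fun k l =>
    ∫ A : Matrix.unitaryGroup (Fin 2) ℂ, symMat ℓ (A : Matrix (Fin 2) (Fin 2) ℂ) k i *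
      symMat ℓ ((A⁻¹ : Matrix.unitaryGroup (Fin 2) ℂ) : Matrix (Fin 2) (Fin 2) ℂ) j l ∂μ
  have hint : ∀ k l, Integrable (fun A : Matrix.unitaryGroup (Fin 2) ℂ =>
      symMat ℓ (A : Matrix (Fin 2) (Fin 2) ℂ) k i *
      symMat ℓ ((A⁻¹ : Matrix.unitaryGroup (Fin 2) ℂ) : Matrix (Fin 2) (Fin 2) ℂ) j l) μ := by
    intro k l
    apply integrable_U2
    exact ((continuous_symMat ℓ k i).comp continuous_subtype_val).mul
      ((continuous_symMat ℓ j l).comp (continuous_subtype_val.comp continuous_inv))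
  have hcomm : ∀ (B : Matrix.unitaryGroup (Fin 2) ℂ) (k l : ℕ), l ≤ ℓ →
      ∑ p ∈ Finset.range (ℓ + 1), symMat ℓ (B : Matrix (Fin 2) (Fin 2) ℂ) k p * E p l =
      ∑ p ∈ Finset.range (ℓ + 1), symMat ℓ (B : Matrix (Fin 2) (Fin 2) ℂ) p l * E k p := by
    intro B k l hl
    have h := integral_mul_left_eq_self (μ := μ) (fun A : Matrix.unitaryGroup (Fin 2) ℂ =>
      symMat ℓ (A : Matrix (Fin 2) (Fin 2) ℂ) k i *
      symMat ℓ ((A⁻¹ * B : Matrix.unitaryGroup (Fin 2) ℂ) : Matrix (Fin 2) (Fin 2) ℂ) j l) B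
    have e1 : ∀ A : Matrix.unitaryGroup (Fin 2) ℂ, (B * A)⁻¹ * B = A⁻¹ := by
      intro A; group
    simp only [e1] at h
    simp only [Submonoid.coe_mul] at h
    simp only [symMat_mul ℓ _ _ _ i hi, symMat_mul ℓ _ _ _ l hl] at h
    simp only [E, ← integral_const_mul]
    rw [← integral_finsetSum _ (fun p _ => (hint _ _).const_mul _),
      ← integral_finsetSum _ (fun p _ => (hint _ _).const_mul _)]
    convert h using 2
    · ext A
      rw [Finset.sum_mul]
      exact Finset.sum_congr rfl fun _ _ => by ring
    · ext A
      rw [Finset.mul_sum]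
      exact Finset.sum_congr rfl fun _ _ => by ring
  have hoff : ∀ k l, k ≤ ℓ → l ≤ ℓ → k ≠ l → E k l = 0 := by
    intro k l hk hl hkl
    have hz := Complex.isPrimitiveRoot_exp (ℓ + 1) (Nat.succ_ne_zero ℓ)
    have hz1 := hz.norm'_eq_one (Nat.succ_ne_zero ℓ)
    set z := Complex.exp (2 * Real.pi * Complex.I / ((ℓ + 1 : ℕ) : ℂ))
    have h := hcomm ⟨_, diag_mem z hz1⟩ k l hl
    simp only [symMat_diag, ite_mul, zero_mul] at h
    rw [Finset.sum_ite_eq', Finset.sum_ite_eq, if_pos (by simp; omega), if_pos (by simp; omega)] at h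
    have hne : z ^ (ℓ - k) ≠ z ^ (ℓ - l) := by
      intro he
      have := hz.pow_inj (by omega) (by omega) he
      omega
    have : (z ^ (ℓ - k) - z ^ (ℓ - l)) * E k l = 0 := by linear_combination h
    exact (mul_eq_zero.1 this).resolve_left (sub_ne_zero.2 hne)
  have hdiag : ∀ k ≤ ℓ, E k k = E ℓ ℓ := by
    intro k hk
    have h := hcomm ⟨_, rot_mem⟩ k ℓ le_rfl
    rw [Finset.sum_eq_single ℓ, Finset.sum_eq_single k] at h
    · have hne := symMat_rot_ne ℓ k hk !![(3/5 : ℂ), 4/5; -4/5, 3/5] (by simp) (by simp)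
      exact (mul_left_cancel₀ hne h).symm
    · intro b hb hbk
      rw [hoff k b hk (by simpa [Nat.lt_succ_iff] using hb) hbk.symm, mul_zero]
    · intro hb; simp at hb; omega
    · intro b hb hbk
      rw [hoff b ℓ (by simpa [Nat.lt_succ_iff] using hb) le_rfl hbk, mul_zero]
    · intro hb; simp at hb
  have htr : ∑ k ∈ Finset.range (ℓ + 1), E k k = if i = j then 1 else 0 := by
    simp only [E]
    rw [← integral_finsetSum _ (fun p _ => hint _ _)]
    have : ∀ A : Matrix.unitaryGroup (Fin 2) ℂ, ∑ k ∈ Finset.range (ℓ + 1),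
        symMat ℓ (A : Matrix (Fin 2) (Fin 2) ℂ) k i *
        symMat ℓ ((A⁻¹ : Matrix.unitaryGroup (Fin 2) ℂ) : Matrix (Fin 2) (Fin 2) ℂ) j k =
        if i = j then 1 else 0 := by
      intro A
      rw [← symMat_one ℓ j i]
      have : (1 : Matrix (Fin 2) (Fin 2) ℂ) =
        ((A⁻¹ : Matrix.unitaryGroup (Fin 2) ℂ) : Matrix (Fin 2) (Fin 2) ℂ) * A := by
        rw [← Submonoid.coe_mul, inv_mul_cancel]; rfl
      rw [this, symMat_mul ℓ _ _ _ _ hi]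
      exact Finset.sum_congr rfl fun _ _ => by ring
    simp only [this]
    simp
  have hEll : ((ℓ : ℂ) + 1) * E ℓ ℓ = if i = j then 1 else 0 := by
    rw [← htr, Finset.sum_congr rfl (fun k hk => hdiag k (by simpa [Nat.lt_succ_iff] using hk))]
    simp
  have hne : (ℓ : ℂ) + 1 ≠ 0 := by exact_mod_cast Nat.succ_ne_zero ℓ
  change E k l = _
  by_cases hkl : k = l
  · subst hkl
    rw [hdiag k hk]
    by_cases hij : i = j
    · simp only [hij, if_true, and_self] at hEll ⊢
      exact eq_inv_of_mul_eq_one_right hEll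
    · simp only [hij, if_false, and_false] at hEll ⊢
      exact (mul_eq_zero.1 hEll).resolve_left hne
  · simp [hkl, hoff k l hk hl hkl]

theorem chi_integral (n ℓ : ℕ) [MeasurableSpace (Matrix.unitaryGroup (Fin 2) ℂ)]
    [BorelSpace (Matrix.unitaryGroup (Fin 2) ℂ)]
    (μ : Measure (Matrix.unitaryGroup (Fin 2) ℂ))
    [μ.IsHaarMeasure] [IsProbabilityMeasure μ] (i k : ℕ) (hi : i ≤ ℓ) (hk : k ≤ ℓ) :
    ∫ A : Matrix.unitaryGroup (Fin 2) ℂ,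
      chiFn n ℓ ((A⁻¹ : Matrix.unitaryGroup (Fin 2) ℂ) : Matrix (Fin 2) (Fin 2) ℂ) *
      ((A : Matrix (Fin 2) (Fin 2) ℂ).det ^ n * symMat ℓ (A : Matrix (Fin 2) (Fin 2) ℂ) k i) ∂μ =
      if i = k then 1 else 0 := by
  have e : ∀ A : Matrix.unitaryGroup (Fin 2) ℂ,
      chiFn n ℓ ((A⁻¹ : Matrix.unitaryGroup (Fin 2) ℂ) : Matrix (Fin 2) (Fin 2) ℂ) *
      ((A : Matrix (Fin 2) (Fin 2) ℂ).det ^ n * symMat ℓ (A : Matrix (Fin 2) (Fin 2) ℂ) k i) =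
      ∑ j ∈ Finset.range (ℓ + 1), ((ℓ : ℂ) + 1) * (symMat ℓ (A : Matrix (Fin 2) (Fin 2) ℂ) k i *
      symMat ℓ ((A⁻¹ : Matrix.unitaryGroup (Fin 2) ℂ) : Matrix (Fin 2) (Fin 2) ℂ) j j) := by
    intro A
    have hd : ((A⁻¹ : Matrix.unitaryGroup (Fin 2) ℂ) : Matrix (Fin 2) (Fin 2) ℂ).det ^ n *
        (A : Matrix (Fin 2) (Fin 2) ℂ).det ^ n = 1 := by
      rw [← mul_pow, ← Matrix.det_mul, ← Submonoid.coe_mul, inv_mul_cancel]; simp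
    simp only [chiFn, piAct, coeff_smul, smul_eq_mul, ← Finset.mul_sum]
    simp only [symMat]
    linear_combination ((ℓ : ℂ) + 1) * (∑ j ∈ Finset.range (ℓ + 1), coeff (monExp ℓ j)
      (symPowAct ((A⁻¹ : Matrix.unitaryGroup (Fin 2) ℂ) : Matrix (Fin 2) (Fin 2) ℂ)
        (monomial (monExp ℓ j) 1))) * (coeff (monExp ℓ k)
      (symPowAct (A : Matrix (Fin 2) (Fin 2) ℂ)
        (monomial (monExp ℓ i) 1))) * hd
  simp only [e]
  rw [integral_finsetSum]
  · simp only [integral_const_mul]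
    rw [Finset.sum_congr rfl (fun j hj => by
      rw [schur_orth ℓ μ i j k j hi hk (by simpa [Nat.lt_succ_iff] using hj)])]
    have hne : (ℓ : ℂ) + 1 ≠ 0 := by exact_mod_cast Nat.succ_ne_zero ℓ
    rw [Finset.sum_eq_single k]
    · simp only [true_and, mul_ite, mul_zero, mul_inv_cancel₀ hne]
    · intro b _ hb
      simp [hb.symm]
    · intro hb; simp at hb; omega
  · intro j _
    apply Integrable.const_mul
    apply integrable_U2
    exact ((continuous_symMat ℓ k i).comp continuous_subtype_val).mul
      ((continuous_symMat ℓ j j).comp (continuous_subtype_val.comp continuous_inv))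

theorem pure_part (n ℓ : ℕ) [MeasurableSpace (Matrix.unitaryGroup (Fin 2) ℂ)]
    [BorelSpace (Matrix.unitaryGroup (Fin 2) ℂ)]
    (μ : Measure (Matrix.unitaryGroup (Fin 2) ℂ))
    [μ.IsHaarMeasure] [IsProbabilityMeasure μ] (G H : Matrix (Fin 2) (Fin 2) ℂ)
    (P : MvPolynomial (Fin 2) ℂ) (hP : P.IsHomogeneous ℓ) (d : Fin 2 →₀ ℕ) :
    ∫ A : Matrix.unitaryGroup (Fin 2) ℂ,
      chiFn n ℓ ((A⁻¹ : Matrix.unitaryGroup (Fin 2) ℂ) : Matrix (Fin 2) (Fin 2) ℂ) *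
      coeff d (piAct n (G * (A : Matrix (Fin 2) (Fin 2) ℂ) * H) P) ∂μ =
    coeff d (piAct n G (piAct n H P)) := by
  have hQ := symPowAct_homog H P ℓ hP
  set Q := symPowAct H P with hQdef
  have e : ∀ A : Matrix.unitaryGroup (Fin 2) ℂ,
      chiFn n ℓ ((A⁻¹ : Matrix.unitaryGroup (Fin 2) ℂ) : Matrix (Fin 2) (Fin 2) ℂ) *
      coeff d (piAct n (G * (A : Matrix (Fin 2) (Fin 2) ℂ) * H) P) =
      ∑ i ∈ Finset.range (ℓ + 1), ∑ k ∈ Finset.range (ℓ + 1),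
      (G.det ^ n * H.det ^ n * coeff (monExp ℓ i) Q *
        coeff d (symPowAct G (monomial (monExp ℓ k) 1))) *
      (chiFn n ℓ ((A⁻¹ : Matrix.unitaryGroup (Fin 2) ℂ) : Matrix (Fin 2) (Fin 2) ℂ) *
      ((A : Matrix (Fin 2) (Fin 2) ℂ).det ^ n *
        symMat ℓ (A : Matrix (Fin 2) (Fin 2) ℂ) k i)) := by
    intro A
    have h1 : coeff d (symPowAct G (symPowAct (A : Matrix (Fin 2) (Fin 2) ℂ) Q)) =
        ∑ i ∈ Finset.range (ℓ + 1), ∑ k ∈ Finset.range (ℓ + 1), coeff (monExp ℓ i) Q *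
          (symMat ℓ (A : Matrix (Fin 2) (Fin 2) ℂ) k i *
            coeff d (symPowAct G (monomial (monExp ℓ k) 1))) := by
      conv_lhs => rw [homog_expand Q ℓ hQ]
      simp only [map_sum, map_smul, coeff_sum, coeff_smul, smul_eq_mul]
      apply Finset.sum_congr rfl
      intro i hi
      rw [← Finset.mul_sum]
      congr 1
      conv_lhs => rw [homog_expand _ ℓ (symPowAct_homog (A : Matrix (Fin 2) (Fin 2) ℂ) _ ℓ
        (monomial_homog ℓ i (by simpa [Nat.lt_succ_iff] using hi)))]
      simp only [map_sum, map_smul, coeff_sum, coeff_smul, smul_eq_mul]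
      rfl
    rw [piAct, symPowAct_mul, symPowAct_mul, ← hQdef, coeff_smul, h1, smul_eq_mul,
      Matrix.det_mul, Matrix.det_mul]
    simp only [Finset.mul_sum]
    refine Finset.sum_congr rfl fun i _ => Finset.sum_congr rfl fun k _ => ?_
    ring
  have hint : ∀ i k (c : ℂ), Integrable (fun A : Matrix.unitaryGroup (Fin 2) ℂ => c *
      (chiFn n ℓ ((A⁻¹ : Matrix.unitaryGroup (Fin 2) ℂ) : Matrix (Fin 2) (Fin 2) ℂ) *
      ((A : Matrix (Fin 2) (Fin 2) ℂ).det ^ n *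
        symMat ℓ (A : Matrix (Fin 2) (Fin 2) ℂ) k i))) μ := by
    intro i k c
    apply Integrable.const_mul
    apply integrable_U2
    have h1 : Continuous fun A : Matrix (Fin 2) (Fin 2) ℂ => A.det ^ n := by fun_prop
    exact ((continuous_chiFn n ℓ).comp (continuous_subtype_val.comp continuous_inv)).mul
      ((h1.mul (continuous_symMat ℓ k i)).comp continuous_subtype_val)
  simp only [e]
  rw [integral_finsetSum _ (fun i _ => integrable_finsetSum _ fun k _ => hint i k _)]
  have h2 : piAct n G (piAct n H P) = (G.det ^ n * H.det ^ n) • symPowAct G Q := by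
    simp only [piAct, map_smul, smul_smul, hQdef]
  rw [h2]
  conv_rhs => rw [homog_expand Q ℓ hQ]
  simp only [map_sum, map_smul, coeff_sum, coeff_smul, smul_eq_mul, Finset.mul_sum]
  apply Finset.sum_congr rfl
  intro i hi
  have hi' : i ≤ ℓ := by simpa [Nat.lt_succ_iff] using hi
  rw [integral_finsetSum _ (fun k _ => hint i k _)]
  simp only [integral_const_mul]
  rw [Finset.sum_congr rfl (fun k hk => by
    rw [chi_integral n ℓ μ i k hi' (by simpa [Nat.lt_succ_iff] using hk)])]
  simp only [mul_ite, mul_one, mul_zero]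
  rw [Finset.sum_ite_eq, if_pos hi]
  ring

theorem blockA_mul (g h : Matrix (Fin 3) (Fin 3) ℂ) (A : Matrix (Fin 2) (Fin 2) ℂ) :
    blockA (g * embedK A * h) = blockA g * A * blockA h +
      A.det⁻¹ • Matrix.of fun i j : Fin 2 => g i.castSucc 2 * h 2 j.castSucc := by
  ext i j
  fin_cases i <;> fin_cases j <;>
  simp [blockA, embedK, Matrix.mul_apply, Fin.sum_univ_succ] <;> ring

/-- `Φ = Φ_{n,ℓ}` satisfies the defining integral equation of a spherical function of type
`(n,ℓ)` for the pair `(SU(3), S(U(2)×U(1)))`: for all `g, h ∈ SU(3)`,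
`Φ(g)∘Φ(h) = ∫_{U(2)} χ(A⁻¹) Φ(g·k(A)·h) dA`, stated here applied to an arbitrary
homogeneous polynomial `P` of degree ℓ and coefficientwise (the integral of an
`End(V_ℓ)`-valued function being taken entrywise with respect to the normalized Haar
probability measure on `U(2)`). -/
theorem stmt4 (n ℓ : ℕ)
    [MeasurableSpace (Matrix.unitaryGroup (Fin 2) ℂ)]
    [BorelSpace (Matrix.unitaryGroup (Fin 2) ℂ)]
    (μ : Measure (Matrix.unitaryGroup (Fin 2) ℂ))
    [μ.IsHaarMeasure] [IsProbabilityMeasure μ]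
    (g h : Matrix (Fin 3) (Fin 3) ℂ)
    (hg : g ∈ Matrix.specialUnitaryGroup (Fin 3) ℂ)
    (hh : h ∈ Matrix.specialUnitaryGroup (Fin 3) ℂ)
    (P : MvPolynomial (Fin 2) ℂ) (hP : P ∈ homogeneousSubmodule (Fin 2) ℓ (R := ℂ))
    (d : Fin 2 →₀ ℕ) :
    coeff d (piAct n (blockA g) (piAct n (blockA h) P)) =
      ∫ A : Matrix.unitaryGroup (Fin 2) ℂ,
        chiFn n ℓ ((A⁻¹ : Matrix.unitaryGroup (Fin 2) ℂ) : Matrix (Fin 2) (Fin 2) ℂ) *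
          coeff d (piAct n (blockA (g * embedK (A : Matrix (Fin 2) (Fin 2) ℂ) * h)) P)
        ∂μ := by
  have hP' : P.IsHomogeneous ℓ := hP
  rw [← pure_part n ℓ μ (blockA g) (blockA h) P hP' d]
  set N : Matrix (Fin 2) (Fin 2) ℂ :=
    Matrix.of fun i j : Fin 2 => g i.castSucc 2 * h 2 j.castSucc with hN
  simp only [blockA_mul, ← hN]
  generalize blockA g = G
  generalize blockA h = H
  obtain ⟨D, hD⟩ := poly_piAct n P
  have hdet : ∀ A : Matrix.unitaryGroup (Fin 2) ℂ, (A : Matrix (Fin 2) (Fin 2) ℂ).det ≠ 0 := by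
    intro A h0
    have : ((A⁻¹ * A : Matrix.unitaryGroup (Fin 2) ℂ) : Matrix (Fin 2) (Fin 2) ℂ).det = 1 := by
      rw [inv_mul_cancel]; simp
    rw [Submonoid.coe_mul, Matrix.det_mul, h0] at this
    simp at this
  let F : ℂ → Matrix.unitaryGroup (Fin 2) ℂ → ℂ := fun w A =>
    chiFn n ℓ ((A⁻¹ : Matrix.unitaryGroup (Fin 2) ℂ) : Matrix (Fin 2) (Fin 2) ℂ) *
      coeff d (piAct n (G * (A : Matrix (Fin 2) (Fin 2) ℂ) * H +
        (w * (A : Matrix (Fin 2) (Fin 2) ℂ).det⁻¹) • N) P)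
  have hFint : ∀ w, Integrable (F w) μ := by
    intro w
    apply integrable_U2
    have hc : Continuous fun A : Matrix.unitaryGroup (Fin 2) ℂ =>
        (A : Matrix (Fin 2) (Fin 2) ℂ).det :=
      Continuous.matrix_det continuous_subtype_val
    have hc2 : Continuous fun A : Matrix.unitaryGroup (Fin 2) ℂ =>
        (A : Matrix (Fin 2) (Fin 2) ℂ).det⁻¹ := hc.inv₀ hdet
    refine ((continuous_chiFn n ℓ).comp (continuous_subtype_val.comp continuous_inv)).mul
      ((continuous_coeff_piAct n P d).comp ?_)
    have := continuous_subtype_val (p := fun A => A ∈ Matrix.unitaryGroup (Fin 2) ℂ)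
    fun_prop
  have hrot : ∀ w : ℂ, ‖w‖ = 1 → ∫ A, F w A ∂μ = ∫ A, F 1 A ∂μ := by
    intro w hw
    obtain ⟨z, hz⟩ := IsAlgClosed.exists_pow_nat_eq w⁻¹ (n := 3) (by norm_num)
    have hz1 : ‖z‖ = 1 := by
      have : ‖z‖ ^ 3 = 1 := by rw [← norm_pow, hz, norm_inv, hw, inv_one]
      exact (pow_eq_one_iff_of_nonneg (norm_nonneg z) (by norm_num)).1 this
    have hz0 : z ≠ 0 := by intro h0; simp [h0] at hz1
    have hzw : z ^ 3 * w = 1 := by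
      rw [hz, inv_mul_cancel₀]; intro h0; simp [h0] at hw
    have hzs : star z * z = 1 := by
      have := Complex.conj_mul' z
      simpa [hz1] using this
    obtain ⟨Z, hZ⟩ : ∃ Z : Matrix.unitaryGroup (Fin 2) ℂ,
        (Z : Matrix (Fin 2) (Fin 2) ℂ) = z • 1 := ⟨⟨_, scalar_mem z hz1⟩, rfl⟩
    suffices key : ∀ A, F w A = F 1 (Z * A) by
      rw [← integral_mul_left_eq_self (μ := μ) (F 1) Z]
      simp only [key]
    intro A
    simp only [F]
    have e1 : (((Z * A : Matrix.unitaryGroup (Fin 2) ℂ)) :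
        Matrix (Fin 2) (Fin 2) ℂ) = z • (A : Matrix (Fin 2) (Fin 2) ℂ) := by
      rw [Submonoid.coe_mul, hZ, Matrix.smul_mul, Matrix.one_mul]
    have e2 : (((Z * A : Matrix.unitaryGroup (Fin 2) ℂ)⁻¹ :
        Matrix.unitaryGroup (Fin 2) ℂ) : Matrix (Fin 2) (Fin 2) ℂ) =
        star z • ((A⁻¹ : Matrix.unitaryGroup (Fin 2) ℂ) : Matrix (Fin 2) (Fin 2) ℂ) := by
      rw [Matrix.UnitaryGroup.inv_val, Matrix.UnitaryGroup.inv_val, e1, star_smul]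
    rw [e1, e2, chiFn_smul]
    have e3 : G * (z • (A : Matrix (Fin 2) (Fin 2) ℂ)) * H +
        (1 * (z • (A : Matrix (Fin 2) (Fin 2) ℂ)).det⁻¹) • N =
        z • (G * (A : Matrix (Fin 2) (Fin 2) ℂ) * H +
        (w * (A : Matrix (Fin 2) (Fin 2) ℂ).det⁻¹) • N) := by
      rw [Matrix.mul_smul, Matrix.smul_mul, smul_add, smul_smul, Matrix.det_smul]
      congr 2
      simp only [Fintype.card_fin, mul_inv, one_mul]
      rw [← mul_assoc]
      congr 1
      apply inv_eq_of_mul_eq_one_right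
      linear_combination hzw
    rw [e3, piAct_smul n z _ P ℓ hP', coeff_smul, smul_eq_mul]
    have e4 : star z ^ (2 * n + ℓ) * z ^ (2 * n + ℓ) = 1 := by rw [← mul_pow, hzs, one_pow]
    rw [mul_mul_mul_comm, e4, one_mul]
  have hζ := Complex.isPrimitiveRoot_exp (D + 1) (Nat.succ_ne_zero D)
  have hζ1 := hζ.norm'_eq_one (Nat.succ_ne_zero D)
  set ζ := Complex.exp (2 * Real.pi * Complex.I / ((D + 1 : ℕ) : ℂ))
  have havg : ∀ A, ∑ k ∈ Finset.range (D + 1), F (ζ ^ k) A = ((D : ℂ) + 1) * F 0 A := by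
    intro A
    obtain ⟨p, hp, e⟩ := hD d (G * (A : Matrix (Fin 2) (Fin 2) ℂ) * H) N
    simp only [F, e, ← Finset.mul_sum]
    rw [root_average D p hp ζ hζ]
    simp only [zero_mul]
    ring
  have hfin : ((D : ℂ) + 1) * ∫ A, F 1 A ∂μ = ((D : ℂ) + 1) * ∫ A, F 0 A ∂μ := by
    rw [← integral_const_mul _ (F 0)]
    simp only [← havg]
    rw [integral_finsetSum _ (fun k _ => hFint _)]
    rw [Finset.sum_congr rfl (fun k _ => hrot (ζ ^ k) (by rw [norm_pow, hζ1, one_pow]))]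
    simp
  have hne : (D : ℂ) + 1 ≠ 0 := by exact_mod_cast Nat.succ_ne_zero D
  have := mul_left_cancel₀ hne hfin
  simp only [F, zero_mul, one_mul, zero_smul, add_zero] at this
  exact this.symm
end

section
/- Let n ∈ ℤ and ℓ ≥ 0 be integers such that n + j ≠ 0 for j = 1, …, ℓ+1 (so that A₀ is invertible and L(λ) is defined). Then for all λ, μ ∈ ℂ: det(μI − L(λ)) = Π_{k=0}^{ℓ} (μ − μ_k(λ)), where μ_k(λ) = λ(n−ℓ+3k) − 3k(ℓ−k+1)(n+k+1). -/
open Matrix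

noncomputable def matA0 (n : ℤ) (ℓ : ℕ) : Matrix (Fin (ℓ + 1)) (Fin (ℓ + 1)) ℂ :=
  Matrix.diagonal fun i => (n : ℂ) + ℓ - i + 1

noncomputable def matB0 (ℓ : ℕ) : Matrix (Fin (ℓ + 1)) (Fin (ℓ + 1)) ℂ :=
  Matrix.of fun i j => ((i : ℂ) + 1) * ((ℓ : ℂ) - i) *
    ((if (j : ℕ) = (i : ℕ) + 1 then 1 else 0) - if j = i then 1 else 0)

noncomputable def matC0 (n : ℤ) (ℓ : ℕ) : Matrix (Fin (ℓ + 1)) (Fin (ℓ + 1)) ℂ :=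
  Matrix.of fun i j =>
    ((n : ℂ) - ℓ + 3 * i) * ((n : ℂ) + ℓ - i + 1) * (if j = i then 1 else 0)
      - 3 * ((i : ℂ) + 1) * ((ℓ : ℂ) - i) * (if (j : ℕ) = (i : ℕ) + 1 then 1 else 0)

noncomputable def matD0 (n : ℤ) (ℓ : ℕ) : Matrix (Fin (ℓ + 1)) (Fin (ℓ + 1)) ℂ :=
  Matrix.of fun i j =>
    ((n : ℂ) + 2 * ℓ - 3 * i) * ((i : ℂ) + 1) * ((ℓ : ℂ) - i) *
        ((if (j : ℕ) = (i : ℕ) + 1 then 1 else 0) - if j = i then 1 else 0)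
      - 3 * ((n : ℂ) + ℓ - i + 1) * (i : ℂ) * ((ℓ : ℂ) - i + 1) *
        ((if j = i then 1 else 0) - if (j : ℕ) + 1 = (i : ℕ) then 1 else 0)

/-- The matrix `L(λ) = D₀ − C₀A₀⁻¹(B₀ − λI)`. -/
noncomputable def matL (n : ℤ) (ℓ : ℕ) (lam : ℂ) : Matrix (Fin (ℓ + 1)) (Fin (ℓ + 1)) ℂ :=
  matD0 n ℓ - matC0 n ℓ * (matA0 n ℓ)⁻¹ *
    (matB0 ℓ - lam • (1 : Matrix (Fin (ℓ + 1)) (Fin (ℓ + 1)) ℂ))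


/-- Superdiagonal coefficients. -/
noncomputable def sCoef (n : ℤ) (ℓ : ℕ) (i : ℕ) : ℂ :=
  -(((i : ℂ) + 1) * ((ℓ : ℂ) - i)) / ((n : ℂ) + ℓ - i)

/-- Entries of the exponential of the superdiagonal matrix with entries `sCoef`. -/
noncomputable def uCoef (n : ℤ) (ℓ : ℕ) (i k : ℕ) : ℂ :=
  if i ≤ k then (∏ j ∈ Finset.Ico i k, sCoef n ℓ j) / ((k - i).factorial : ℂ) else 0

lemma uCoef_self (n : ℤ) (ℓ i : ℕ) : uCoef n ℓ i i = 1 := by simp [uCoef]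

lemma uCoef_lt (n : ℤ) (ℓ i k : ℕ) (h : k < i) : uCoef n ℓ i k = 0 := by
  simp [uCoef, h]

lemma uCoef_left (n : ℤ) (ℓ i k : ℕ) :
    ((k : ℂ) - i) * uCoef n ℓ i k = sCoef n ℓ i * uCoef n ℓ (i + 1) k := by
  rcases lt_trichotomy i k with h | h | h
  · obtain ⟨d, rfl⟩ := Nat.exists_eq_add_of_lt h
    have e1 : i + d + 1 - i = d + 1 := by omega
    have e2 : i + d + 1 - (i + 1) = d := by omega
    have h1 : ((d : ℂ) + 1) ≠ 0 := Nat.cast_add_one_ne_zero d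
    have h2 : ((d.factorial : ℕ) : ℂ) ≠ 0 := Nat.cast_ne_zero.mpr d.factorial_ne_zero
    rw [uCoef, uCoef, if_pos (by omega), if_pos (by omega), e1, e2,
      Finset.prod_eq_prod_Ico_succ_bot h, Nat.factorial_succ]
    push_cast
    field_simp
    ring
  · subst h
    simp [uCoef_lt]
  · rw [uCoef_lt _ _ _ _ h, uCoef_lt _ _ _ _ (by omega)]
    simp

lemma uCoef_right (n : ℤ) (ℓ i k : ℕ) :
    ((k : ℂ) + 1 - i) * uCoef n ℓ i (k + 1) = sCoef n ℓ k * uCoef n ℓ i k := by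
  rcases lt_trichotomy i (k + 1) with h | h | h
  · obtain ⟨d, rfl⟩ := Nat.exists_eq_add_of_le (Nat.lt_succ_iff.mp h)
    have e1 : i + d + 1 - i = d + 1 := by omega
    have e2 : i + d - i = d := by omega
    have h1 : ((d : ℂ) + 1) ≠ 0 := Nat.cast_add_one_ne_zero d
    have h2 : ((d.factorial : ℕ) : ℂ) ≠ 0 := Nat.cast_ne_zero.mpr d.factorial_ne_zero
    rw [uCoef, uCoef, if_pos (by omega), if_pos (by omega), e1, e2,
      Finset.prod_Ico_succ_top (by omega), Nat.factorial_succ]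
    push_cast
    field_simp
    ring
  · subst h
    rw [uCoef_lt _ _ (k + 1) k (by omega)]
    simp
  · rw [uCoef_lt _ _ _ _ h, uCoef_lt _ _ _ _ (by omega)]
    simp

/-- Product with a tridiagonal matrix. -/
lemma tri_mul {ℓ : ℕ} (P X : Matrix (Fin (ℓ + 1)) (Fin (ℓ + 1)) ℂ)
    (a b c : ℕ → ℂ) (x : ℕ → Fin (ℓ + 1) → ℂ)
    (hP : ∀ i j, P i j = a i * (if j = i then 1 else 0)
      + b i * (if (j : ℕ) = (i : ℕ) + 1 then 1 else 0)
      + c i * (if (j : ℕ) + 1 = (i : ℕ) then 1 else 0))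
    (hX : ∀ i j, X i j = x i j) (hb : b ℓ = 0) (hc : c 0 = 0) (i k : Fin (ℓ + 1)) :
    (P * X) i k = a i * x i k + b i * x (i + 1) k + c i * x (i - 1) k := by
  have h1 : ∀ f : ℕ → ℂ, ∑ j : Fin (ℓ + 1), b i * (if (j : ℕ) = (i : ℕ) + 1 then 1 else 0) * f j
      = b i * f (i + 1) := by
    intro f
    by_cases h : (i : ℕ) = ℓ
    · simp [h, hb]
    · rw [Finset.sum_eq_single (⟨i + 1, by omega⟩ : Fin (ℓ + 1))]
      · simp
      · intro j _ hj
        rw [if_neg]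
        · simp
        · intro h'; exact hj (Fin.ext h')
      · simp
  have h2 : ∀ f : ℕ → ℂ, ∑ j : Fin (ℓ + 1), c i * (if (j : ℕ) + 1 = (i : ℕ) then 1 else 0) * f j
      = c i * f (i - 1) := by
    intro f
    by_cases h : (i : ℕ) = 0
    · simp [h, hc]
    · rw [Finset.sum_eq_single (⟨i - 1, by omega⟩ : Fin (ℓ + 1))]
      · rw [if_pos (by simp; omega)]; simp
      · intro j _ hj
        rw [if_neg]
        · simp
        · intro h'; exact hj (Fin.ext (by simp; omega))
      · simp
  rw [Matrix.mul_apply]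
  simp only [hP, hX, add_mul, Finset.sum_add_distrib]
  rw [h1 (fun j => x j k), h2 (fun j => x j k)]
  simp

/-- The scalar identity behind the triangularization. -/
lemma key_identity (n : ℤ) (ℓ : ℕ) (hn : ∀ j : ℕ, 1 ≤ j → j ≤ ℓ + 1 → n + j ≠ 0)
    (lam : ℂ) (i k : ℕ) (hi : i ≤ ℓ) (hk : k ≤ ℓ) :
    let u := uCoef n ℓ
    let y : ℕ → ℂ := fun i => -(((i : ℂ) + 1) * ((ℓ : ℂ) - i)) * u i k
      + ((i : ℂ) + 1) * ((ℓ : ℂ) - i) * u (i + 1) k - lam * u i k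
    let z : ℕ → ℂ := fun i => ((n : ℂ) + ℓ - i + 1)⁻¹ * y i
    ((-(((n : ℂ) + 2 * ℓ - 3 * i) * ((i : ℂ) + 1) * ((ℓ : ℂ) - i))
        - 3 * ((n : ℂ) + ℓ - i + 1) * (i : ℂ) * ((ℓ : ℂ) - i + 1)) * u i k
      + ((n : ℂ) + 2 * ℓ - 3 * i) * ((i : ℂ) + 1) * ((ℓ : ℂ) - i) * u (i + 1) k
      + 3 * ((n : ℂ) + ℓ - i + 1) * (i : ℂ) * ((ℓ : ℂ) - i + 1) * u (i - 1) k)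
    - (((n : ℂ) - ℓ + 3 * i) * ((n : ℂ) + ℓ - i + 1) * z i
      + -(3 * ((i : ℂ) + 1) * ((ℓ : ℂ) - i)) * z (i + 1))
    = (lam * ((n : ℂ) - ℓ + 3 * k) - 3 * k * ((ℓ : ℂ) - k + 1) * ((n : ℂ) + k + 1)) * u i k
      + 3 * ((k : ℂ) + 1) * ((ℓ : ℂ) - k) * ((n : ℂ) + ℓ - k) * u i (k + 1) := by
  intro u y z
  have hne : ∀ j : ℕ, j ≤ ℓ → (n : ℂ) + ℓ - j + 1 ≠ 0 := by
    intro j hj h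
    apply hn (ℓ - j + 1) (by omega) (by omega)
    have : ((n + ((ℓ - j + 1 : ℕ) : ℤ) : ℤ) : ℂ) = 0 := by
      push_cast [Nat.cast_sub hj]
      linear_combination h
    exact_mod_cast this
  have hs : ∀ j : ℕ, j ≤ ℓ → ((j : ℂ) + 1) * ((ℓ : ℂ) - j) = - sCoef n ℓ j * ((n : ℂ) + ℓ - j) := by
    intro j hj
    rcases hj.eq_or_lt with h | h
    · subst h; simp [sCoef]
    · have := hne (j + 1) h
      push_cast at this
      have h' : (n : ℂ) + ℓ - j ≠ 0 := by
        intro h0; apply this; linear_combination h0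
      rw [sCoef]; field_simp
  have hs2 : sCoef n ℓ i * (((i : ℂ) + 2) * ((ℓ : ℂ) - i - 1))
      = - sCoef n ℓ i * sCoef n ℓ (i + 1) * ((n : ℂ) + ℓ - i - 1) := by
    rcases hi.eq_or_lt with h | h
    · subst h; simp [sCoef]
    · have := hs (i + 1) h
      push_cast at this
      linear_combination sCoef n ℓ i * this
  have hl1 : ((k : ℂ) - i) * u i k = sCoef n ℓ i * u (i + 1) k := uCoef_left n ℓ i k
  have hl2 : ((k : ℂ) - i - 1) * u (i + 1) k = sCoef n ℓ (i + 1) * u (i + 2) k := by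
    have := uCoef_left n ℓ (i + 1) k
    push_cast at this
    linear_combination this
  have hr : ((k : ℂ) + 1 - i) * u i (k + 1) = sCoef n ℓ k * u i k := uCoef_right n ℓ i k
  have hz1 : ((n : ℂ) + ℓ - i + 1) * z i = y i := by
    simp only [z]; rw [mul_inv_cancel_left₀ (hne i hi)]
  have hz2 : -(3 * ((i : ℂ) + 1) * ((ℓ : ℂ) - i)) * z (i + 1) = 3 * sCoef n ℓ i * y (i + 1) := by
    have e : (n : ℂ) + ℓ - ((i + 1 : ℕ) : ℂ) + 1 = (n : ℂ) + ℓ - i := by push_cast; ring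
    simp only [z]
    rw [e, sCoef]
    ring
  have hy2 : sCoef n ℓ i * y (i + 1) = (-(((i : ℂ) + 2) * ((ℓ : ℂ) - i - 1))
      - ((n : ℂ) + ℓ - i - 1) * ((k : ℂ) - i - 1) - lam) * (((k : ℂ) - i) * u i k) := by
    simp only [y]
    push_cast
    linear_combination u (i + 2) k * hs2 + (((n : ℂ) + ℓ - i - 1) * sCoef n ℓ i) * hl2
      - (-(((i : ℂ) + 2) * ((ℓ : ℂ) - i - 1))
      - ((n : ℂ) + ℓ - i - 1) * ((k : ℂ) - i - 1) - lam) * hl1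
  have hui : ((i : ℂ) + 1) * ((ℓ : ℂ) - i) * u (i + 1) k
      = -((n : ℂ) + ℓ - i) * (((k : ℂ) - i) * u i k) := by
    linear_combination u (i + 1) k * hs i hi + ((n : ℂ) + ℓ - i) * hl1
  have hyi : y i = (-(((i : ℂ) + 1) * ((ℓ : ℂ) - i)) - ((n : ℂ) + ℓ - i) * ((k : ℂ) - i) - lam)
      * u i k := by
    simp only [y]
    linear_combination hui
  have e1 : ((n : ℂ) - ℓ + 3 * i) * ((n : ℂ) + ℓ - i + 1) * z i = ((n : ℂ) - ℓ + 3 * i) * y i := by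
    linear_combination ((n : ℂ) - ℓ + 3 * i) * hz1
  have e2 : 3 * sCoef n ℓ i * y (i + 1) = 3 * (sCoef n ℓ i * y (i + 1)) := by ring
  rw [e1, hz2, e2, hy2, hyi]
  by_cases hik : i = k + 1
  · subst hik
    have v0 : u (k + 1) k = 0 := uCoef_lt _ _ _ _ (by omega)
    have v1 : u (k + 1 + 1) k = 0 := uCoef_lt _ _ _ _ (by omega)
    have v2 : u (k + 1 - 1) k = 1 := uCoef_self _ _ _
    have v3 : u (k + 1) (k + 1) = 1 := uCoef_self _ _ _
    rw [v0, v1, v2, v3]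
    push_cast
    ring
  · have hd : ((k : ℂ) + 1 - i) ≠ 0 := by
      intro h
      apply hik
      have : ((k + 1 : ℕ) : ℂ) = (i : ℂ) := by push_cast; linear_combination h
      exact (by exact_mod_cast this.symm)
    have hlow : ((k : ℂ) + 1 - i) *
        (((n : ℂ) + ℓ - i + 1) * (i : ℂ) * ((ℓ : ℂ) - i + 1) * u (i - 1) k)
        = - ((i : ℂ) * ((ℓ : ℂ) - i + 1)) ^ 2 * u i k := by
      rcases Nat.eq_zero_or_pos i with h | h
      · subst h; simp
      · obtain ⟨m, hm⟩ := Nat.exists_eq_add_of_lt h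
        rw [zero_add] at hm
        have h3 := uCoef_left n ℓ m k
        have h4 := hs m (by omega)
        have hm' : (i : ℂ) = m + 1 := by rw [hm]; push_cast; ring
        have hm2 : i - 1 = m := by omega
        rw [hm2, hm']
        rw [← hm] at h3
        change ((k : ℂ) - m) * u m k = sCoef n ℓ m * u i k at h3
        linear_combination (((n : ℂ) + ℓ - m) * (m + 1) * (ℓ - m)) * h3
          + (((m : ℂ) + 1) * (ℓ - m) * u i k) * h4
    have hright : ((k : ℂ) + 1 - i) *
        (((k : ℂ) + 1) * ((ℓ : ℂ) - k) * ((n : ℂ) + ℓ - k) * u i (k + 1))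
        = - (((k : ℂ) + 1) * ((ℓ : ℂ) - k)) ^ 2 * u i k := by
      linear_combination (((k : ℂ) + 1) * ((ℓ : ℂ) - k) * ((n : ℂ) + ℓ - k)) * hr
        + (((k : ℂ) + 1) * (ℓ - k) * u i k) * hs k hk
    apply mul_left_cancel₀ hd
    linear_combination 3 * hlow - 3 * hright
      + ((k : ℂ) + 1 - i) * ((n : ℂ) + 2 * ℓ - 3 * i) * hui

/-- The characteristic polynomial of `L(λ)`:
`det(μI − L(λ)) = ∏_{k=0}^{ℓ} (μ − μ_k(λ))` with
`μ_k(λ) = λ(n−ℓ+3k) − 3k(ℓ−k+1)(n+k+1)`. -/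
theorem stmt11 (n : ℤ) (ℓ : ℕ)
    (hn : ∀ j : ℕ, 1 ≤ j → j ≤ ℓ + 1 → n + j ≠ 0) :
    ∀ lam mu : ℂ,
      (mu • (1 : Matrix (Fin (ℓ + 1)) (Fin (ℓ + 1)) ℂ) - matL n ℓ lam).det =
        ∏ k ∈ Finset.range (ℓ + 1),
          (mu - (lam * ((n : ℂ) - ℓ + 3 * k)
            - 3 * k * ((ℓ : ℂ) - k + 1) * ((n : ℂ) + k + 1))) := by
  intro lam mu
  have hne : ∀ j : ℕ, j ≤ ℓ → (n : ℂ) + ℓ - j + 1 ≠ 0 := by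
    intro j hj h
    apply hn (ℓ - j + 1) (by omega) (by omega)
    have : ((n + ((ℓ - j + 1 : ℕ) : ℤ) : ℤ) : ℂ) = 0 := by
      push_cast [Nat.cast_sub hj]
      linear_combination h
    exact_mod_cast this
  let U : Matrix (Fin (ℓ + 1)) (Fin (ℓ + 1)) ℂ := Matrix.of fun i k => uCoef n ℓ i k
  let T : Matrix (Fin (ℓ + 1)) (Fin (ℓ + 1)) ℂ := Matrix.of fun j k =>
    (lam * ((n : ℂ) - ℓ + 3 * k) - 3 * k * ((ℓ : ℂ) - k + 1) * ((n : ℂ) + k + 1)) *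
      (if j = k then 1 else 0)
    + 3 * ((k : ℂ) + 1) * ((ℓ : ℂ) - k) * ((n : ℂ) + ℓ - k) *
      (if (j : ℕ) = (k : ℕ) + 1 then 1 else 0)
  have hUdet : U.det = 1 := by
    rw [Matrix.det_of_upperTriangular]
    · simp [U, uCoef_self]
    · intro i j hij
      exact uCoef_lt _ _ _ _ hij
  have hTdet : (mu • (1 : Matrix (Fin (ℓ + 1)) (Fin (ℓ + 1)) ℂ) - T).det =
      ∏ k ∈ Finset.range (ℓ + 1), (mu - (lam * ((n : ℂ) - ℓ + 3 * k)
            - 3 * k * ((ℓ : ℂ) - k + 1) * ((n : ℂ) + k + 1))) := by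
    rw [Matrix.det_of_lowerTriangular, Finset.prod_range]
    · simp [T]
    · intro i j hij
      have h1 : i < j := hij
      have h2 : i ≠ j := h1.ne
      have h3 : (i : ℕ) ≠ (j : ℕ) + 1 := by have : (i : ℕ) < j := h1; omega
      simp [T, h2, h3]
  have hA : (matA0 n ℓ)⁻¹ = Matrix.diagonal fun i : Fin (ℓ + 1) => ((n : ℂ) + ℓ - i + 1)⁻¹ := by
    apply Matrix.inv_eq_right_inv
    rw [matA0, Matrix.diagonal_mul_diagonal, ← Matrix.diagonal_one]
    congr 1
    funext i
    exact mul_inv_cancel₀ (hne i (Nat.lt_succ_iff.mp i.2))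
  have hY : ∀ i k, ((matB0 ℓ - lam • (1 : Matrix (Fin (ℓ + 1)) (Fin (ℓ + 1)) ℂ)) * U) i k =
      -(((i : ℂ) + 1) * ((ℓ : ℂ) - i)) * uCoef n ℓ i k
      + ((i : ℂ) + 1) * ((ℓ : ℂ) - i) * uCoef n ℓ (i + 1) k - lam * uCoef n ℓ i k := by
    intro i k
    rw [Matrix.sub_mul, Matrix.sub_apply, tri_mul (matB0 ℓ) U
      (fun i => -(((i : ℂ) + 1) * ((ℓ : ℂ) - i))) (fun i => ((i : ℂ) + 1) * ((ℓ : ℂ) - i))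
      (fun _ => 0) (fun i k => uCoef n ℓ i k)
      (by intro i j; simp only [matB0, Matrix.of_apply]; ring) (by intro i j; rfl) (by simp) rfl]
    simp [U]
  have hZ : ∀ i k, ((matA0 n ℓ)⁻¹ *
      ((matB0 ℓ - lam • (1 : Matrix (Fin (ℓ + 1)) (Fin (ℓ + 1)) ℂ)) * U)) i k =
      ((n : ℂ) + ℓ - i + 1)⁻¹ * (-(((i : ℂ) + 1) * ((ℓ : ℂ) - i)) * uCoef n ℓ i k
      + ((i : ℂ) + 1) * ((ℓ : ℂ) - i) * uCoef n ℓ (i + 1) k - lam * uCoef n ℓ i k) := by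
    intro i k
    rw [hA, Matrix.diagonal_mul, hY]
  have hLU : matL n ℓ lam * U = U * T := by
    ext i k
    rw [matL, Matrix.sub_mul, Matrix.mul_assoc, Matrix.mul_assoc, Matrix.sub_apply]
    rw [tri_mul (matD0 n ℓ) U
      (fun i => -(((n : ℂ) + 2 * ℓ - 3 * i) * ((i : ℂ) + 1) * ((ℓ : ℂ) - i))
        - 3 * ((n : ℂ) + ℓ - i + 1) * (i : ℂ) * ((ℓ : ℂ) - i + 1))
      (fun i => ((n : ℂ) + 2 * ℓ - 3 * i) * ((i : ℂ) + 1) * ((ℓ : ℂ) - i))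
      (fun i => 3 * ((n : ℂ) + ℓ - i + 1) * (i : ℂ) * ((ℓ : ℂ) - i + 1))
      (fun i k => uCoef n ℓ i k)
      (by intro i j; simp only [matD0, Matrix.of_apply]; ring) (by intro i j; rfl)
      (by simp) (by simp)]
    rw [tri_mul (matC0 n ℓ) _
      (fun i => ((n : ℂ) - ℓ + 3 * i) * ((n : ℂ) + ℓ - i + 1))
      (fun i => -(3 * ((i : ℂ) + 1) * ((ℓ : ℂ) - i))) (fun _ => 0)
      (fun i k => ((n : ℂ) + ℓ - i + 1)⁻¹ * (-(((i : ℂ) + 1) * ((ℓ : ℂ) - i)) * uCoef n ℓ i k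
      + ((i : ℂ) + 1) * ((ℓ : ℂ) - i) * uCoef n ℓ (i + 1) k - lam * uCoef n ℓ i k))
      (by intro i j; simp only [matC0, Matrix.of_apply]; ring) hZ (by simp) rfl]
    rw [← Matrix.transpose_apply (U * T), Matrix.transpose_mul]
    rw [tri_mul Tᵀ Uᵀ
      (fun k => lam * ((n : ℂ) - ℓ + 3 * k) - 3 * k * ((ℓ : ℂ) - k + 1) * ((n : ℂ) + k + 1))
      (fun k => 3 * ((k : ℂ) + 1) * ((ℓ : ℂ) - k) * ((n : ℂ) + ℓ - k)) (fun _ => 0)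
      (fun k i => uCoef n ℓ i k)
      (by intro i j; simp only [T, Matrix.transpose_apply, Matrix.of_apply]; ring)
      (by intro i j; rfl) (by simp) rfl]
    have := key_identity n ℓ hn lam i k (Nat.lt_succ_iff.mp i.2) (Nat.lt_succ_iff.mp k.2)
    simp only at this
    simp only [zero_mul, add_zero]
    exact this
  have hmain : (mu • (1 : Matrix (Fin (ℓ + 1)) (Fin (ℓ + 1)) ℂ) - matL n ℓ lam) * U
      = U * (mu • (1 : Matrix (Fin (ℓ + 1)) (Fin (ℓ + 1)) ℂ) - T) := by
    rw [Matrix.sub_mul, Matrix.mul_sub, hLU]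
    simp
  have hdet := congrArg Matrix.det hmain
  rw [Matrix.det_mul, Matrix.det_mul, hUdet, mul_one, one_mul, hTdet] at hdet
  exact hdet
end
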